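/- arXiv:math/0512583 — 10 statements merged into one kernel-verified Lean document; each statement's English description precedes it below -/
import Mathlib

section
/- Let b=(b₁,b₂,b₃,b₄)∈(ℂ^×)⁴ satisfy the smoothness condition Δ(b)≠0, and let θ=θ(b). Then for every natural number N≥1 the fixed point set {x ∈ S(θ) : c^N(x) = x} of the N-th iterate of the Coxeter transformation c on the affine cubic surface S(θ) is a finite set; in particular, c admits no curve of periodic points of any period on S(θ). -/
open Finset

noncomputable section

/-- The cubic polynomial `f(x,θ) = x₁x₂x₃ + x₁²+x₂²+x₃² − θ₁x₁ − θ₂x₂ − θ₃x₃ + θ₄`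
(indices shifted to start at 0). -/
def fcubic (θ : Fin 4 → ℂ) (x : Fin 3 → ℂ) : ℂ :=
  x 0 * x 1 * x 2 + x 0 ^ 2 + x 1 ^ 2 + x 2 ^ 2
    - θ 0 * x 0 - θ 1 * x 1 - θ 2 * x 2 + θ 3

/-- The involution `σᵢ : (σᵢ x)ᵢ = θᵢ − xᵢ − xⱼx_k`, other coordinates unchanged. -/
def sigmaMap (θ : Fin 4 → ℂ) (i : Fin 3) (x : Fin 3 → ℂ) : Fin 3 → ℂ :=
  Function.update x i (θ i.castSucc - x i - ∏ l ∈ Finset.univ.erase i, x l)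

/-- The Coxeter transformation `c = σ₁ ∘ σ₂ ∘ σ₃` (σ₃ applied first). -/
def coxeter (θ : Fin 4 → ℂ) : (Fin 3 → ℂ) → (Fin 3 → ℂ) :=
  sigmaMap θ 0 ∘ sigmaMap θ 1 ∘ sigmaMap θ 2

/-- `aᵢ = bᵢ + bᵢ⁻¹`. -/
def aOf (b : Fin 4 → ℂ) (l : Fin 4) : ℂ := b l + (b l)⁻¹

/-- `θ(b)`: `θᵢ = aᵢa₄ + aⱼa_k` for `{i,j,k} = {1,2,3}` and
`θ₄ = a₁a₂a₃a₄ + a₁²+a₂²+a₃²+a₄² − 4`. -/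
def thetaOf (b : Fin 4 → ℂ) : Fin 4 → ℂ :=
  ![aOf b 0 * aOf b 3 + aOf b 1 * aOf b 2,
    aOf b 1 * aOf b 3 + aOf b 0 * aOf b 2,
    aOf b 2 * aOf b 3 + aOf b 0 * aOf b 1,
    aOf b 0 * aOf b 1 * aOf b 2 * aOf b 3
      + aOf b 0 ^ 2 + aOf b 1 ^ 2 + aOf b 2 ^ 2 + aOf b 3 ^ 2 - 4]

/-- The discriminant `Δ(b) = ∏ₗ(bₗ−bₗ⁻¹)² · ∏_{ε∈{±1}⁴}(b^ε − 1)`. -/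
def Delta (b : Fin 4 → ℂ) : ℂ :=
  (∏ l, (b l - (b l)⁻¹) ^ 2) *
    ∏ ε : Fin 4 → Bool, ((∏ l, if ε l then b l else (b l)⁻¹) - 1)

/-- A bounded algebraic subset of `ℂⁿ` is finite. -/
theorem MvPolynomial.zeroLocus_finite_of_isBounded {n : ℕ} (I : Ideal (MvPolynomial (Fin n) ℂ))
    (hI : Bornology.IsBounded (MvPolynomial.zeroLocus ℂ I)) :
    (MvPolynomial.zeroLocus ℂ I).Finite := by
  by_cases htop : I = ⊤
  · simp [htop]
  obtain ⟨s, -, g, hinj, hint⟩ := exists_integral_inj_algHom_of_quotient I htop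
  rcases s with _ | s
  · -- every coordinate takes its values among the roots of a fixed monic polynomial
    choose P hPm hP using fun i : Fin n => hint (Ideal.Quotient.mk I (X i))
    refine (Set.Finite.pi' fun i =>
      ((P i).map (aeval (R := ℂ) (isEmptyElim : Fin 0 → ℂ)).toRingHom).rootSet_finite ℂ).subset ?_
    intro x hx i
    let ev : (MvPolynomial (Fin n) ℂ ⧸ I) →ₐ[ℂ] ℂ := Ideal.Quotient.liftₐ I (aeval x) hx
    have hev : ev.comp g = aeval (R := ℂ) (isEmptyElim : Fin 0 → ℂ) :=
      MvPolynomial.algHom_ext fun i => i.elim0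
    have hroot := congrArg ev (hP i)
    rw [map_zero] at hroot
    rw [Polynomial.mem_rootSet]
    refine ⟨((hPm i).map _).ne_zero, ?_⟩
    rw [← hev]
    have hX : ev (Ideal.Quotient.mk I (X i)) = x i :=
      aeval_X x i
    have h2 := Polynomial.hom_eval₂ (P i) (g : _ →+* _) (ev : _ →+* ℂ) (Ideal.Quotient.mk I (X i))
    simp only [RingHom.coe_coe, hX] at h2
    rw [Polynomial.coe_aeval_eq_eval, Polynomial.eval_map]
    exact h2.symm.trans hroot
  · -- a transcendental element of the coordinate ring takes every complex value
    exfalso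
    obtain ⟨F, hF⟩ := Ideal.Quotient.mk_surjective (g (X 0))
    have hsurj (z : ℂ) : ∃ x ∈ zeroLocus ℂ I, aeval x F = z := by
      have hnu : ¬ IsUnit (g (X 0 - C z)) := by
        have : IsLocalHom g.toRingHom := hint.isLocalHom hinj
        intro hu
        have hu' : IsUnit (X 0 - C z : MvPolynomial (Fin (s + 1)) ℂ) :=
          isUnit_of_map_unit g.toRingHom _ hu
        simpa using hu'.map (aeval (R := ℂ) fun _ : Fin (s + 1) => z)
      obtain ⟨m, hm, hmem⟩ := exists_max_ideal_of_mem_nonunits hnu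
      have := Ideal.comap_isMaximal_of_surjective (Ideal.Quotient.mk I)
        Ideal.Quotient.mk_surjective (K := m)
      obtain ⟨x, hx⟩ := eq_vanishingIdeal_singleton_of_isMaximal ℂ this
      refine ⟨x, fun p hp => ?_, ?_⟩
      · rw [← mem_vanishingIdeal_singleton_iff, ← hx, Ideal.mem_comap,
          Ideal.Quotient.eq_zero_iff_mem.mpr hp]
        exact m.zero_mem
      · have hmem' : F - C z ∈ vanishingIdeal ℂ {x} := by
          rw [← hx, Ideal.mem_comap, map_sub, hF]
          have hC : Ideal.Quotient.mk I (C z) = g (C z) := (g.commutes z).symm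
          rwa [hC, ← map_sub]
        rw [mem_vanishingIdeal_singleton_iff, map_sub, sub_eq_zero] at hmem'
        simpa using hmem'
    have hcont : Continuous fun x : Fin n → ℂ => aeval x F := by
      simpa [aeval_eq_eval] using MvPolynomial.continuous_eval F
    obtain ⟨R, hR⟩ := (hI.isCompact_closure.image hcont).isBounded.exists_norm_le
    obtain ⟨x, hx, hxz⟩ := hsurj (((|R| + 1 : ℝ)) : ℂ)
    have := hR _ ⟨x, subset_closure hx, rfl⟩
    simp only [hxz, Complex.norm_real, Real.norm_eq_abs] at this
    rw [abs_of_nonneg (by positivity)] at this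
    linarith [le_abs_self R]

theorem coxeter_apply_two (θ : Fin 4 → ℂ) (x : Fin 3 → ℂ) :
    coxeter θ x 2 = θ 2 - x 2 - x 0 * x 1 := by
  have h : (univ.erase 2 : Finset (Fin 3)) = {0, 1} := by decide
  simp [coxeter, sigmaMap, h]

theorem coxeter_apply_one (θ : Fin 4 → ℂ) (x : Fin 3 → ℂ) :
    coxeter θ x 1 = θ 1 - x 1 - x 0 * coxeter θ x 2 := by
  have h : (univ.erase 2 : Finset (Fin 3)) = {0, 1} := by decide
  have h' : (univ.erase 1 : Finset (Fin 3)) = {0, 2} := by decide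
  simp [coxeter, sigmaMap, h, h']

theorem coxeter_apply_zero (θ : Fin 4 → ℂ) (x : Fin 3 → ℂ) :
    coxeter θ x 0 = θ 0 - x 0 - coxeter θ x 1 * coxeter θ x 2 := by
  have h : (univ.erase 2 : Finset (Fin 3)) = {0, 1} := by decide
  have h' : (univ.erase 1 : Finset (Fin 3)) = {0, 2} := by decide
  have h'' : (univ.erase 0 : Finset (Fin 3)) = {1, 2} := by decide
  simp [coxeter, sigmaMap, h, h', h'']

theorem fcubic_coxeter (θ : Fin 4 → ℂ) (x : Fin 3 → ℂ) :
    fcubic θ (coxeter θ x) = fcubic θ x := by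
  simp only [fcubic, coxeter_apply_zero, coxeter_apply_one, coxeter_apply_two]
  ring

/-- On a cubic surface, a coordinate `m` whose products with the other two are at most linear in
`‖m‖` is bounded. -/
theorem norm_le_of_cubic_eq_zero {m a b α β γ δ : ℂ} {K : ℝ}
    (hα : ‖α‖ ≤ K) (hβ : ‖β‖ ≤ K) (hγ : ‖γ‖ ≤ K) (hδ : ‖δ‖ ≤ K)
    (ha : ‖m * a‖ ≤ 2 * ‖m‖ + K) (hb : ‖m * b‖ ≤ 2 * ‖m‖ + K)
    (h : m * a * b + m ^ 2 + a ^ 2 + b ^ 2 - α * m - β * a - γ * b + δ = 0) :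
    ‖m‖ ≤ 1 + 3 * (2 + K) ^ 2 + 2 * K * (2 + K) + 2 * K := by
  have hK : 0 ≤ K := (norm_nonneg α).trans hα
  by_contra! hlt
  have hm : 1 ≤ ‖m‖ := by nlinarith [mul_nonneg hK hK]
  have small {t : ℂ} (ht : ‖m * t‖ ≤ 2 * ‖m‖ + K) : ‖t‖ ≤ 2 + K := by
    rw [norm_mul] at ht
    by_contra! hc
    nlinarith
  have hsa := small ha
  have hsb := small hb
  have hm2 : m ^ 2 = -(m * a * b) - a ^ 2 - b ^ 2 + α * m + β * a + γ * b - δ := by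
    linear_combination h
  have hnorm : ‖m‖ ^ 2 ≤ ‖m‖ * ‖a‖ * ‖b‖ + ‖a‖ ^ 2 + ‖b‖ ^ 2 + ‖α‖ * ‖m‖ + ‖β‖ * ‖a‖
      + ‖γ‖ * ‖b‖ + ‖δ‖ := by
    simp only [← norm_pow, ← norm_mul]
    calc ‖m ^ 2‖ = ‖-(m * a * b) - a ^ 2 - b ^ 2 + α * m + β * a + γ * b - δ‖ := by rw [hm2]
      _ ≤ ‖-(m * a * b)‖ + ‖a ^ 2‖ + ‖b ^ 2‖ + ‖α * m‖ + ‖β * a‖ + ‖γ * b‖ + ‖δ‖ := by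
        refine (norm_sub_le _ _).trans (add_le_add_left ?_ _)
        refine (norm_add_le _ _).trans (add_le_add_left ?_ _)
        refine (norm_add_le _ _).trans (add_le_add_left ?_ _)
        refine (norm_add_le _ _).trans (add_le_add_left ?_ _)
        refine (norm_sub_le _ _).trans (add_le_add_left ?_ _)
        exact norm_sub_le _ _
      _ = _ := by rw [norm_neg]
  have hle : ‖m‖ ^ 2 ≤ ‖m‖ * (2 + K) * (2 + K) + (2 + K) ^ 2 + (2 + K) ^ 2 + K * ‖m‖
      + K * (2 + K) + K * (2 + K) + K := hnorm.trans (by gcongr)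
  have hpos : 0 ≤ 2 * (2 + K) ^ 2 + 2 * (K * (2 + K)) + K := by positivity
  nlinarith [mul_le_mul_of_nonneg_right hm hpos]

/-- A point of an orbit of `c` on the cubic surface whose norm is at least that of its two
neighbours lies in a fixed ball. -/
theorem norm_coxeter_le {θ : Fin 4 → ℂ} {w : Fin 3 → ℂ} (hw : fcubic θ w = 0)
    (hprev : ‖w‖ ≤ ‖coxeter θ w‖) (hnext : ‖coxeter θ (coxeter θ w)‖ ≤ ‖coxeter θ w‖) :
    ‖coxeter θ w‖ ≤ 1 + 3 * (2 + ‖θ‖) ^ 2 + 2 * ‖θ‖ * (2 + ‖θ‖) + 2 * ‖θ‖ := by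
  have hθ (i : Fin 4) : ‖θ i‖ ≤ ‖θ‖ := norm_le_pi_norm θ i
  have hy : fcubic θ (coxeter θ w) = 0 := (fcubic_coxeter θ w).trans hw
  have w0 := coxeter_apply_zero θ w
  have w1 := coxeter_apply_one θ w
  set y := coxeter θ w
  have y0 := coxeter_apply_zero θ y
  have y1 := coxeter_apply_one θ y
  have y2 := coxeter_apply_two θ y
  set z := coxeter θ y
  have hwi (i : Fin 3) : ‖w i‖ ≤ ‖y‖ := (norm_le_pi_norm w i).trans hprev
  have hyi (i : Fin 3) : ‖y i‖ ≤ ‖y‖ := norm_le_pi_norm y i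
  have hzi (i : Fin 3) : ‖z i‖ ≤ ‖y‖ := (norm_le_pi_norm z i).trans hnext
  have key {t u v : ℂ} {i : Fin 4} (hu : ‖u‖ ≤ ‖y‖) (hv : ‖v‖ ≤ ‖y‖) (ht : t = θ i - u - v) :
      ‖t‖ ≤ 2 * ‖y‖ + ‖θ‖ := by
    rw [ht]
    linarith [norm_sub_le (θ i - u) v, norm_sub_le (θ i) u, hθ i]
  obtain ⟨i, hi⟩ : ∃ i, ‖y i‖ = ‖y‖ := by
    obtain ⟨i, -, hi⟩ := exists_max_image univ (fun i => ‖y i‖) univ_nonempty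
    exact ⟨i, le_antisymm (hyi i) <|
      (pi_norm_le_iff_of_nonneg (norm_nonneg _)).2 fun j => hi j (mem_univ j)⟩
  rw [← hi]
  simp only [fcubic] at hy
  fin_cases i <;> simp only [Fin.zero_eta, Fin.mk_one, Fin.reduceFinMk] at hi ⊢
  · refine norm_le_of_cubic_eq_zero (a := y 1) (b := z 2) (hθ 0) (hθ 1) (hθ 2) (hθ 3) ?_ ?_ ?_
    · exact hi ▸ key (i := 2) (hyi 2) (hzi 2) (by linear_combination y2)
    · exact hi ▸ key (i := 1) (hyi 1) (hzi 1) (by linear_combination y1)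
    · rw [y2]
      linear_combination hy
  · refine norm_le_of_cubic_eq_zero (a := y 0) (b := y 2) (hθ 1) (hθ 0) (hθ 2) (hθ 3) ?_ ?_ ?_
    · exact hi ▸ key (i := 2) (hyi 2) (hzi 2) (by linear_combination y2)
    · exact hi ▸ key (i := 0) (hyi 0) (hwi 0) (by linear_combination w0)
    · linear_combination hy
  · refine norm_le_of_cubic_eq_zero (a := y 1) (b := w 0) (hθ 2) (hθ 1) (hθ 0) (hθ 3) ?_ ?_ ?_
    · exact hi ▸ key (i := 0) (hyi 0) (hwi 0) (by linear_combination w0)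
    · exact hi ▸ key (i := 1) (hyi 1) (hwi 1) (by linear_combination w1)
    · rw [w0] at hy
      linear_combination hy

theorem fcubic_iterate_coxeter (θ : Fin 4 → ℂ) (k : ℕ) (x : Fin 3 → ℂ) :
    fcubic θ ((coxeter θ)^[k] x) = fcubic θ x := by
  induction k with
  | zero => rfl
  | succ k ih => rw [Function.iterate_succ_apply', fcubic_coxeter, ih]

theorem norm_le_of_iterate_coxeter_eq {θ : Fin 4 → ℂ} {N : ℕ} (hN : 1 ≤ N) {x : Fin 3 → ℂ}
    (hx : fcubic θ x = 0) (hfix : (coxeter θ)^[N] x = x) :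
    ‖x‖ ≤ 1 + 3 * (2 + ‖θ‖) ^ 2 + 2 * ‖θ‖ * (2 + ‖θ‖) + 2 * ‖θ‖ := by
  have hper : Function.IsPeriodicPt (coxeter θ) N x := hfix
  obtain ⟨k, -, hk⟩ := exists_max_image (range N) (fun k => ‖(coxeter θ)^[k] x‖)
    ⟨0, mem_range.2 hN⟩
  have hmax (j : ℕ) : ‖(coxeter θ)^[j] x‖ ≤ ‖(coxeter θ)^[k] x‖ := by
    rw [← hper.iterate_mod_apply j]
    exact hk _ (mem_range.2 (Nat.mod_lt _ hN))
  have hshift : (coxeter θ)^[k] x = coxeter θ ((coxeter θ)^[k + N - 1] x) := by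
    rw [← Function.iterate_succ_apply' (coxeter θ), Nat.succ_eq_add_one,
      Nat.sub_add_cancel (by omega), Function.iterate_add_apply, hfix]
  refine (hmax 0).trans ?_
  rw [hshift]
  refine norm_coxeter_le ((fcubic_iterate_coxeter ..).trans hx) ?_ ?_ <;> rw [← hshift]
  · exact hmax _
  · rw [← Function.iterate_succ_apply' (coxeter θ)]
    exact hmax _

theorem exists_mvPolynomial_sigmaMap (θ : Fin 4 → ℂ) (i : Fin 3)
    {F : (Fin 3 → ℂ) → Fin 3 → ℂ}
    (hF : ∃ Q : Fin 3 → MvPolynomial (Fin 3) ℂ, ∀ x j, MvPolynomial.aeval x (Q j) = F x j) :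
    ∃ Q : Fin 3 → MvPolynomial (Fin 3) ℂ,
      ∀ x j, MvPolynomial.aeval x (Q j) = sigmaMap θ i (F x) j := by
  obtain ⟨Q, hQ⟩ := hF
  refine ⟨Function.update Q i
    (MvPolynomial.C (θ i.castSucc) - Q i - ∏ l ∈ univ.erase i, Q l), fun x j => ?_⟩
  rcases eq_or_ne j i with rfl | hj
  · simp only [sigmaMap, Function.update_self, map_sub, map_prod, hQ]
    simp
  · simp only [sigmaMap, Function.update_of_ne hj, hQ]

theorem exists_mvPolynomial_iterate_coxeter (θ : Fin 4 → ℂ) (N : ℕ) :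
    ∃ Q : Fin 3 → MvPolynomial (Fin 3) ℂ,
      ∀ x j, MvPolynomial.aeval x (Q j) = (coxeter θ)^[N] x j := by
  induction N with
  | zero => exact ⟨MvPolynomial.X, fun x j => MvPolynomial.aeval_X x j⟩
  | succ N ih =>
    simp only [Function.iterate_succ_apply']
    exact exists_mvPolynomial_sigmaMap θ 0 (exists_mvPolynomial_sigmaMap θ 1
      (exists_mvPolynomial_sigmaMap θ 2 ih))

open MvPolynomial in
theorem finite_setOf_iterate_coxeter_eq (θ : Fin 4 → ℂ) {N : ℕ} (hN : 1 ≤ N) :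
    {x : Fin 3 → ℂ | fcubic θ x = 0 ∧ (coxeter θ)^[N] x = x}.Finite := by
  obtain ⟨Q, hQ⟩ := exists_mvPolynomial_iterate_coxeter θ N
  let f : MvPolynomial (Fin 3) ℂ := X 0 * X 1 * X 2 + X 0 ^ 2 + X 1 ^ 2 + X 2 ^ 2
    - C (θ 0) * X 0 - C (θ 1) * X 1 - C (θ 2) * X 2 + C (θ 3)
  have hf (x : Fin 3 → ℂ) : aeval x f = fcubic θ x := by simp [f, fcubic]
  have hset : {x : Fin 3 → ℂ | fcubic θ x = 0 ∧ (coxeter θ)^[N] x = x} =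
      zeroLocus ℂ (Ideal.span (insert f (Set.range fun i => Q i - X i))) := by
    ext x
    simp [zeroLocus_span, hf, hQ, sub_eq_zero, funext_iff, -aeval_eq_eval]
  have hbdd : Bornology.IsBounded {x : Fin 3 → ℂ | fcubic θ x = 0 ∧ (coxeter θ)^[N] x = x} :=
    isBounded_iff_forall_norm_le.2 ⟨_, fun x hx => norm_le_of_iterate_coxeter_eq hN hx.1 hx.2⟩
  rw [hset] at hbdd ⊢
  exact zeroLocus_finite_of_isBounded _ hbdd

/-- For `b ∈ (ℂ^×)⁴` with `Δ(b) ≠ 0` and `θ = θ(b)`, for every `N ≥ 1` the fixed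
point set of `c^N` on the affine cubic surface `S(θ)` is finite (so `c` admits no curve of
periodic points of any period on `S(θ)`). -/
theorem fixed_points_of_coxeter_iterate_finite
    (b : Fin 4 → ℂ) (hb : ∀ l, b l ≠ 0) (hΔ : Delta b ≠ 0) (N : ℕ) (hN : 1 ≤ N) :
    {x : Fin 3 → ℂ | fcubic (thetaOf b) x = 0 ∧
      (coxeter (thetaOf b))^[N] x = x}.Finite := by
  exact finite_setOf_iterate_coxeter_eq (thetaOf b) hN
end
end

section
/- The composition g₁²∘g₂⁻²∘g₁⁻²∘g₂² : ℂ³×ℂ⁴ → ℂ³×ℂ⁴ (the group commutator of g₁² and g₂⁻², with g₂² applied first) equals (Σ₁∘Σ₂∘Σ₃)², where Σᵢ(x,θ) := (σᵢ(x),θ) with σᵢ the involution attached to the parameter θ. In particular, for each fixed θ this commutator acts on the slice ℂ³×{θ} as the square c² of the Coxeter transformation c=σ₁∘σ₂∘σ₃. -/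
open Finset

noncomputable section

/-- For a cyclic permutation `(i,j,k)` of `(1,2,3)`, the map
`gᵢ(x,θ) = (x',θ')` with `x'ᵢ = θⱼ − xⱼ − x_k·xᵢ`, `x'ⱼ = xᵢ`, `x'_k = x_k`,
`θ'ᵢ = θⱼ`, `θ'ⱼ = θᵢ`, `θ'_k = θ_k`, `θ'₄ = θ₄`. -/
def gMap (i j k : Fin 3) (p : (Fin 3 → ℂ) × (Fin 4 → ℂ)) :
    (Fin 3 → ℂ) × (Fin 4 → ℂ) :=
  (Function.update
      (Function.update p.1 i (p.2 j.castSucc - p.1 j - p.1 k * p.1 i)) j (p.1 i),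
   Function.update
      (Function.update p.2 i.castSucc (p.2 j.castSucc)) j.castSucc (p.2 i.castSucc))

/-- The inverse of `gMap i j k`. -/
def gMapInv (i j k : Fin 3) (p : (Fin 3 → ℂ) × (Fin 4 → ℂ)) :
    (Fin 3 → ℂ) × (Fin 4 → ℂ) :=
  (Function.update
      (Function.update p.1 i (p.1 j)) j (p.2 i.castSucc - p.1 i - p.1 k * p.1 j),
   Function.update
      (Function.update p.2 i.castSucc (p.2 j.castSucc)) j.castSucc (p.2 i.castSucc))

/-- `g₁`, defined via the cyclic permutation `(1,2,3)`. -/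
def g1 : (Fin 3 → ℂ) × (Fin 4 → ℂ) → (Fin 3 → ℂ) × (Fin 4 → ℂ) := gMap 0 1 2
/-- `g₂`, defined via the cyclic permutation `(2,3,1)`. -/
def g2 : (Fin 3 → ℂ) × (Fin 4 → ℂ) → (Fin 3 → ℂ) × (Fin 4 → ℂ) := gMap 1 2 0
/-- `g₃`, defined via the cyclic permutation `(3,1,2)`. -/
def g3 : (Fin 3 → ℂ) × (Fin 4 → ℂ) → (Fin 3 → ℂ) × (Fin 4 → ℂ) := gMap 2 0 1
def g1inv : (Fin 3 → ℂ) × (Fin 4 → ℂ) → (Fin 3 → ℂ) × (Fin 4 → ℂ) := gMapInv 0 1 2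
def g2inv : (Fin 3 → ℂ) × (Fin 4 → ℂ) → (Fin 3 → ℂ) × (Fin 4 → ℂ) := gMapInv 1 2 0

/-- `Σᵢ(x,θ) = (σᵢ(x), θ)`. -/
def SigmaPair (i : Fin 3) (p : (Fin 3 → ℂ) × (Fin 4 → ℂ)) :
    (Fin 3 → ℂ) × (Fin 4 → ℂ) :=
  (sigmaMap p.2 i p.1, p.2)

theorem gMap_gMapInv {i j k : Fin 3} (hij : i ≠ j) (hik : i ≠ k) (hjk : j ≠ k)
    (p : (Fin 3 → ℂ) × (Fin 4 → ℂ)) : gMap i j k (gMapInv i j k p) = p := by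
  ext l
  · by_cases hi : l = i <;> by_cases hj : l = j <;>
      simp_all [gMap, gMapInv, hik.symm, hjk.symm]
    ring
  · by_cases hi : l = i.castSucc <;> by_cases hj : l = j.castSucc <;>
      simp_all [gMap, gMapInv, Function.update_apply]

theorem gMapInv_gMap {i j k : Fin 3} (hij : i ≠ j) (hik : i ≠ k) (hjk : j ≠ k)
    (p : (Fin 3 → ℂ) × (Fin 4 → ℂ)) : gMapInv i j k (gMap i j k p) = p := by
  ext l
  · by_cases hi : l = i <;> by_cases hj : l = j <;>
      simp_all [gMap, gMapInv, hik.symm, hjk.symm]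
    ring
  · by_cases hi : l = i.castSucc <;> by_cases hj : l = j.castSucc <;>
      simp_all [gMap, gMapInv, Function.update_apply]

theorem SigmaPair_involutive (i : Fin 3) : Function.Involutive (SigmaPair i) := by
  intro p
  have hprod (a : ℂ) : ∏ l ∈ Finset.univ.erase i, Function.update p.1 i a l =
      ∏ l ∈ Finset.univ.erase i, p.1 l :=
    Finset.prod_congr rfl fun l hl => Function.update_of_ne (Finset.ne_of_mem_erase hl) _ _
  have hcancel (a b c : ℂ) : a - (a - b - c) - c = b := by ring
  simp [SigmaPair, sigmaMap, hprod, hcancel]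

theorem sigmaMap_zero (θ : Fin 4 → ℂ) (x : Fin 3 → ℂ) :
    sigmaMap θ 0 x = ![θ 0 - x 0 - x 1 * x 2, x 1, x 2] := by
  have h : (Finset.univ.erase 0 : Finset (Fin 3)) = {1, 2} := by decide
  ext l
  fin_cases l <;> simp [sigmaMap, h]

theorem sigmaMap_one (θ : Fin 4 → ℂ) (x : Fin 3 → ℂ) :
    sigmaMap θ 1 x = ![x 0, θ 1 - x 1 - x 0 * x 2, x 2] := by
  have h : (Finset.univ.erase 1 : Finset (Fin 3)) = {0, 2} := by decide
  ext l
  fin_cases l <;> simp [sigmaMap, h]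

theorem sigmaMap_two (θ : Fin 4 → ℂ) (x : Fin 3 → ℂ) :
    sigmaMap θ 2 x = ![x 0, x 1, θ 2 - x 2 - x 0 * x 1] := by
  have h : (Finset.univ.erase 2 : Finset (Fin 3)) = {0, 1} := by decide
  ext l
  fin_cases l <;> simp [sigmaMap, h]

theorem g1_g1 (p : (Fin 3 → ℂ) × (Fin 4 → ℂ)) :
    g1 (g1 p) = SigmaPair 0 (SigmaPair 1 p) := by
  ext l
  · fin_cases l <;>
      simp [g1, gMap, SigmaPair, sigmaMap_zero, sigmaMap_one] <;> ring
  · fin_cases l <;> simp [g1, gMap, SigmaPair]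

theorem g2_g2 (p : (Fin 3 → ℂ) × (Fin 4 → ℂ)) :
    g2 (g2 p) = SigmaPair 1 (SigmaPair 2 p) := by
  ext l
  · fin_cases l <;>
      simp [g2, gMap, SigmaPair, sigmaMap_one, sigmaMap_two]
  · fin_cases l <;> simp [g2, gMap, SigmaPair]

theorem g1_g1inv (p : (Fin 3 → ℂ) × (Fin 4 → ℂ)) : g1 (g1inv p) = p :=
  gMap_gMapInv (by decide) (by decide) (by decide) p

theorem g1inv_g1 (p : (Fin 3 → ℂ) × (Fin 4 → ℂ)) : g1inv (g1 p) = p :=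
  gMapInv_gMap (by decide) (by decide) (by decide) p

theorem g2_g2inv (p : (Fin 3 → ℂ) × (Fin 4 → ℂ)) : g2 (g2inv p) = p :=
  gMap_gMapInv (by decide) (by decide) (by decide) p

theorem g2inv_g2 (p : (Fin 3 → ℂ) × (Fin 4 → ℂ)) : g2inv (g2 p) = p :=
  gMapInv_gMap (by decide) (by decide) (by decide) p

theorem g1inv_g1inv (p : (Fin 3 → ℂ) × (Fin 4 → ℂ)) :
    g1inv (g1inv p) = SigmaPair 1 (SigmaPair 0 p) := by
  have h := g1_g1 (SigmaPair 1 (SigmaPair 0 p))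
  rw [SigmaPair_involutive, SigmaPair_involutive] at h
  conv_lhs => rw [← h, g1inv_g1, g1inv_g1]

theorem g2inv_g2inv (p : (Fin 3 → ℂ) × (Fin 4 → ℂ)) :
    g2inv (g2inv p) = SigmaPair 2 (SigmaPair 1 p) := by
  have h := g2_g2 (SigmaPair 2 (SigmaPair 1 p))
  rw [SigmaPair_involutive, SigmaPair_involutive] at h
  conv_lhs => rw [← h, g2inv_g2, g2inv_g2]

/-- `g1inv`, `g2inv` really are the inverses of `g₁`, `g₂`, and the commutator
`g₁² ∘ g₂⁻² ∘ g₁⁻² ∘ g₂²` (with `g₂²` applied first) equals `(Σ₁∘Σ₂∘Σ₃)²`; in particular on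
each slice `ℂ³ × {θ}` it acts as the square `c²` of the Coxeter transformation. -/
theorem commutator_eq_coxeter_squared :
    (∀ p, g1 (g1inv p) = p ∧ g1inv (g1 p) = p) ∧
    (∀ p, g2 (g2inv p) = p ∧ g2inv (g2 p) = p) ∧
    (g1 ∘ g1 ∘ g2inv ∘ g2inv ∘ g1inv ∘ g1inv ∘ g2 ∘ g2 =
      SigmaPair 0 ∘ SigmaPair 1 ∘ SigmaPair 2 ∘ SigmaPair 0 ∘ SigmaPair 1 ∘ SigmaPair 2) ∧
    (∀ (θ : Fin 4 → ℂ) (x : Fin 3 → ℂ),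
      (g1 ∘ g1 ∘ g2inv ∘ g2inv ∘ g1inv ∘ g1inv ∘ g2 ∘ g2) (x, θ)
        = (coxeter θ (coxeter θ x), θ)) := by
  have key : g1 ∘ g1 ∘ g2inv ∘ g2inv ∘ g1inv ∘ g1inv ∘ g2 ∘ g2 =
      SigmaPair 0 ∘ SigmaPair 1 ∘ SigmaPair 2 ∘ SigmaPair 0 ∘ SigmaPair 1 ∘ SigmaPair 2 := by
    funext p
    simp only [Function.comp_apply, g1_g1, g2_g2, g1inv_g1inv, g2inv_g2inv,
      SigmaPair_involutive _ _]
  refine ⟨fun p => ⟨g1_g1inv p, g1inv_g1 p⟩, fun p => ⟨g2_g2inv p, g2inv_g2 p⟩, key,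
    fun θ x => ?_⟩
  rw [key]
  rfl
end
end

section
/- Each map gᵢ (i=1,2,3) is a bijection of ℂ³×ℂ⁴, and the braid relations hold: g₁∘g₂∘g₁ = g₂∘g₁∘g₂, and g₃ = g₁∘g₂∘g₁⁻¹. -/
open Finset

noncomputable section

theorem leftInverse_gMapInv {i j k : Fin 3} (hij : i ≠ j) (hik : i ≠ k) (hjk : j ≠ k) :
    Function.LeftInverse (gMapInv i j k) (gMap i j k) := by
  rintro ⟨x, θ⟩
  have hc : i.castSucc ≠ j.castSucc := fun h => hij (Fin.castSucc_injective _ h)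
  refine Prod.ext (funext fun l => ?_) (funext fun l => ?_)
  · simp only [gMap, gMapInv, Function.update_apply]
    grind
  · simp only [gMap, gMapInv, Function.update_apply]
    grind

theorem rightInverse_gMapInv {i j k : Fin 3} (hij : i ≠ j) (hik : i ≠ k) (hjk : j ≠ k) :
    Function.RightInverse (gMapInv i j k) (gMap i j k) := by
  rintro ⟨x, θ⟩
  have hc : i.castSucc ≠ j.castSucc := fun h => hij (Fin.castSucc_injective _ h)
  refine Prod.ext (funext fun l => ?_) (funext fun l => ?_)
  · simp only [gMap, gMapInv, Function.update_apply]
    grind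
  · simp only [gMap, gMapInv, Function.update_apply]
    grind

theorem gMap_bijective {i j k : Fin 3} (hij : i ≠ j) (hik : i ≠ k) (hjk : j ≠ k) :
    Function.Bijective (gMap i j k) :=
  ⟨(leftInverse_gMapInv hij hik hjk).injective, (rightInverse_gMapInv hij hik hjk).surjective⟩

theorem g1_g2_g1 : g1 ∘ g2 ∘ g1 = g2 ∘ g1 ∘ g2 := by
  funext ⟨x, θ⟩
  refine Prod.ext (funext fun l => ?_) (funext fun l => ?_) <;> fin_cases l <;>
    simp [g1, g2, gMap, Fin.ext_iff] <;> grind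

theorem g3_comp_g1 : g3 ∘ g1 = g1 ∘ g2 := by
  funext ⟨x, θ⟩
  refine Prod.ext (funext fun l => ?_) (funext fun l => ?_) <;> fin_cases l <;>
    simp [g1, g2, g3, gMap, Fin.ext_iff] <;> grind

/-- each `gᵢ` is a bijection of `ℂ³ × ℂ⁴`, and the braid relations
`g₁∘g₂∘g₁ = g₂∘g₁∘g₂` and `g₃ = g₁∘g₂∘g₁⁻¹` hold. -/
theorem g_bijective_and_braid_relations :
    Function.Bijective g1 ∧ Function.Bijective g2 ∧ Function.Bijective g3 ∧
    g1 ∘ g2 ∘ g1 = g2 ∘ g1 ∘ g2 ∧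
    g3 = g1 ∘ g2 ∘ Function.invFun g1 := by
  have h1 : Function.Bijective g1 := gMap_bijective (by decide) (by decide) (by decide)
  refine ⟨h1, gMap_bijective (by decide) (by decide) (by decide),
    gMap_bijective (by decide) (by decide) (by decide), g1_g2_g1, ?_⟩
  funext p
  obtain ⟨q, rfl⟩ := h1.surjective p
  simpa [Function.leftInverse_invFun h1.injective q] using congrFun g3_comp_g1 q
end
end

section
/- For every cyclic permutation (i,j,k) of (1,2,3) and every (x,θ)∈ℂ³×ℂ⁴, writing gᵢ(x,θ)=(x',θ'), one has f(x',θ') = f(x,θ). In particular gᵢ maps the cubic surface S(θ) bijectively onto the cubic surface S(θ'), where θ' is obtained from θ by exchanging θᵢ and θⱼ. -/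
open Finset

noncomputable section

/-- The cubic polynomial reads the same in every cyclic labelling of the variables. -/
theorem fcubic_eq_of_cyclic {i j k : Fin 3}
    (hcyc : (i, j, k) = (0, 1, 2) ∨ (i, j, k) = (1, 2, 0) ∨ (i, j, k) = (2, 0, 1))
    (θ : Fin 4 → ℂ) (x : Fin 3 → ℂ) :
    fcubic θ x = x i * x j * x k + x i ^ 2 + x j ^ 2 + x k ^ 2
      - θ i.castSucc * x i - θ j.castSucc * x j - θ k.castSucc * x k + θ (Fin.last 3) := by
  simp only [Prod.mk.injEq] at hcyc
  rcases hcyc with ⟨rfl, rfl, rfl⟩ | ⟨rfl, rfl, rfl⟩ | ⟨rfl, rfl, rfl⟩ <;>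
    simp only [fcubic, Fin.isValue, Fin.reduceCastSucc, Fin.reduceLast] <;> ring

theorem ne_of_cyclic {i j k : Fin 3}
    (hcyc : (i, j, k) = (0, 1, 2) ∨ (i, j, k) = (1, 2, 0) ∨ (i, j, k) = (2, 0, 1)) :
    i ≠ j ∧ k ≠ i ∧ k ≠ j := by
  revert i j k
  decide

theorem fcubic_gMap {i j k : Fin 3}
    (hcyc : (i, j, k) = (0, 1, 2) ∨ (i, j, k) = (1, 2, 0) ∨ (i, j, k) = (2, 0, 1))
    (θ : Fin 4 → ℂ) (x : Fin 3 → ℂ) :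
    fcubic (gMap i j k (x, θ)).2 (gMap i j k (x, θ)).1 = fcubic θ x := by
  obtain ⟨hij, hki, hkj⟩ := ne_of_cyclic hcyc
  simp only [fcubic_eq_of_cyclic hcyc, gMap, Function.update_apply, Fin.castSucc_inj,
    (Fin.castSucc_ne_last _).symm, hij, hki, hkj, if_true, if_false]
  ring

/-- For fixed `θ`, the map `gᵢ` has a polynomial inverse on `ℂ³`. -/
theorem gMap_fst_bijective {i j k : Fin 3} (hij : i ≠ j) (hki : k ≠ i) (hkj : k ≠ j)
    (θ : Fin 4 → ℂ) : Function.Bijective fun x => (gMap i j k (x, θ)).1 := by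
  refine Function.bijective_iff_has_inverse.2 ⟨fun y => Function.update
    (Function.update y i (y j)) j (θ j.castSucc - y i - y k * y j), fun x => ?_, fun y => ?_⟩ <;>
  · funext l
    simp only [gMap, Function.update_apply, hij, hki, hkj, if_true, if_false]
    split_ifs with hj hi <;> simp_all
    ring

/-- for every cyclic permutation `(i,j,k)` of `(1,2,3)`, `gᵢ` preserves the cubic
polynomial: `f(x',θ') = f(x,θ)`; in particular it maps `S(θ)` bijectively onto `S(θ')`,
where `θ'` is `θ` with `θᵢ` and `θⱼ` exchanged. -/
theorem gMap_preserves_cubic (i j k : Fin 3)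
    (hcyc : (i, j, k) = (0, 1, 2) ∨ (i, j, k) = (1, 2, 0) ∨ (i, j, k) = (2, 0, 1))
    (θ : Fin 4 → ℂ) :
    (∀ x : Fin 3 → ℂ,
      fcubic (gMap i j k (x, θ)).2 (gMap i j k (x, θ)).1 = fcubic θ x) ∧
    Set.BijOn (fun x => (gMap i j k (x, θ)).1)
      {x | fcubic θ x = 0}
      {x | fcubic (Function.update
        (Function.update θ i.castSucc (θ j.castSucc)) j.castSucc (θ i.castSucc)) x = 0} := by
  refine ⟨fcubic_gMap hcyc θ, ?_⟩
  obtain ⟨hij, hki, hkj⟩ := ne_of_cyclic hcyc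
  have hbij := gMap_fst_bijective hij hki hkj θ
  refine ⟨fun x hx => (fcubic_gMap hcyc θ x).trans hx, hbij.injective.injOn, fun y hy => ?_⟩
  obtain ⟨x, rfl⟩ := hbij.surjective y
  exact ⟨x, (fcubic_gMap hcyc θ x).symm.trans hy, rfl⟩
end
end

section
/- For every θ∈ℂ⁴ and every cyclic permutation (i,j,k) of (1,2,3), define fᵢ(u,θ) = uⱼu_k + u₀(1+uⱼ²+u_k²) − u₀²(θᵢ+θⱼuⱼ+θ_ku_k) + θ₄u₀³ for u=(u₀,uⱼ,u_k)∈ℂ³. If fᵢ(u,θ)=0 and u₀=0, then the gradient (∂fᵢ/∂u₀, ∂fᵢ/∂uⱼ, ∂fᵢ/∂u_k) at u does not vanish. Consequently, the compactified cubic surface is smooth at every point of the tritangent lines at infinity, for every value of θ. -/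
noncomputable section

/-- The directional derivative, at a point with `u 0 = 0`, of the local equation of the cubic
surface in an affine chart. -/
theorem fderiv_chart_apply_of_zero (a b c e : ℂ) (u d : Fin 3 → ℂ) (h0 : u 0 = 0) :
    fderiv ℂ (fun v : Fin 3 → ℂ =>
      v 1 * v 2 + v 0 * (1 + v 1 ^ 2 + v 2 ^ 2)
        - v 0 ^ 2 * (a + b * v 1 + c * v 2) + e * v 0 ^ 3) u d =
      d 0 * (1 + u 1 ^ 2 + u 2 ^ 2) + d 1 * u 2 + d 2 * u 1 := by
  have p (m : Fin 3) : HasFDerivAt (fun v : Fin 3 → ℂ => v m)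
      (ContinuousLinearMap.proj (R := ℂ) (φ := fun _ : Fin 3 => ℂ) m) u :=
    hasFDerivAt_apply m u
  have h := ((((p 1).mul (p 2)).add ((p 0).mul ((((p 1).pow 2).const_add 1).add
    ((p 2).pow 2)))).sub (((p 0).pow 2).mul ((((p 1).const_mul b).const_add a).add
    ((p 2).const_mul c)))).add (((p 0).pow 3).const_mul e)
  refine (DFunLike.congr_fun h.fderiv d).trans ?_
  simp [h0]
  ring

/-- in the chart `Uᵢ`, the local equation
`fᵢ(u,θ) = uⱼu_k + u₀(1+uⱼ²+u_k²) − u₀²(θᵢ+θⱼuⱼ+θ_ku_k) + θ₄u₀³` of the compactified cubic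
surface has nonvanishing gradient at every point of the surface at infinity (`u₀ = 0`);
consequently the compactified cubic surface is smooth along the tritangent lines at
infinity, for every `θ`. Here `u = (u₀,uⱼ,u_k)` is encoded as `u : Fin 3 → ℂ` with
`u₀ = u 0`, `uⱼ = u 1`, `u_k = u 2`. -/
theorem gradient_nonzero_at_infinity (θ : Fin 4 → ℂ) (i j k : Fin 3)
    (hcyc : (i, j, k) = (0, 1, 2) ∨ (i, j, k) = (1, 2, 0) ∨ (i, j, k) = (2, 0, 1))
    (u : Fin 3 → ℂ)
    (hf : u 1 * u 2 + u 0 * (1 + u 1 ^ 2 + u 2 ^ 2)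
        - u 0 ^ 2 * (θ i.castSucc + θ j.castSucc * u 1 + θ k.castSucc * u 2)
        + θ 3 * u 0 ^ 3 = 0)
    (h0 : u 0 = 0) :
    fderiv ℂ (fun v : Fin 3 → ℂ =>
      v 1 * v 2 + v 0 * (1 + v 1 ^ 2 + v 2 ^ 2)
        - v 0 ^ 2 * (θ i.castSucc + θ j.castSucc * v 1 + θ k.castSucc * v 2)
        + θ 3 * v 0 ^ 3) u ≠ 0 := by
  intro h
  have hd (d : Fin 3 → ℂ) : d 0 * (1 + u 1 ^ 2 + u 2 ^ 2) + d 1 * u 2 + d 2 * u 1 = 0 := by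
    rw [← fderiv_chart_apply_of_zero (θ i.castSucc) (θ j.castSucc) (θ k.castSucc) (θ 3) u d h0, h]
    rfl
  have h2 : u 2 = 0 := by simpa using hd ![0, 1, 0]
  have h1 : u 1 = 0 := by simpa using hd ![0, 0, 1]
  simpa [h1, h2] using hd ![1, 0, 0]
end
end

section
/- Let b=(b₁,b₂,b₃,b₄)∈(ℂ^×)⁴, set aᵢ=bᵢ+bᵢ⁻¹, θ=θ(b), and let {i,j,k}={1,2,3}. Then both affine lines Eᵢ = {x∈ℂ³ : xᵢ = bᵢb₄+(bᵢb₄)⁻¹ and xⱼ+(bᵢb₄)x_k = a_k bᵢ + aⱼ b₄} and Eⱼ = {x∈ℂ³ : xᵢ = bⱼb_k+(bⱼb_k)⁻¹ and xⱼ+(bⱼb_k)x_k = a₄ bⱼ + aᵢ b_k} are contained in the affine cubic surface S(θ): every point of Eᵢ or Eⱼ satisfies f(x,θ)=0. -/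
open Finset

noncomputable section

/-- A line along which the quadratic part of the cubic splits off a linear factor. -/
theorem cubic_eq_zero_of_mem_line {p r : ℂ} (hp : p ≠ 0) (hr : r ≠ 0) (u v X Y Z : ℂ)
    (hX : X = p * r + (p * r)⁻¹) (hYZ : Y + p * r * Z = v * p + u * r) :
    X * Y * Z + X ^ 2 + Y ^ 2 + Z ^ 2
      - ((p + p⁻¹) * (r + r⁻¹) + u * v) * X
      - (u * (r + r⁻¹) + v * (p + p⁻¹)) * Y
      - (v * (r + r⁻¹) + u * (p + p⁻¹)) * Z
      + ((p + p⁻¹) * (r + r⁻¹) * u * v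
        + (p + p⁻¹) ^ 2 + (r + r⁻¹) ^ 2 + u ^ 2 + v ^ 2 - 4) = 0 := by
  obtain rfl : Y = v * p + u * r - p * r * Z := by linear_combination hYZ
  subst hX
  field_simp
  ring

/-- The cubic at `θ(b)`, written symmetrically in a labelling `i, j, k` of the coordinates. -/
theorem fcubic_thetaOf (b : Fin 4 → ℂ) (x : Fin 3 → ℂ)
    {i j k : Fin 3} (hij : i ≠ j) (hjk : j ≠ k) (hik : i ≠ k) :
    fcubic (thetaOf b) x =
      x i * x j * x k + x i ^ 2 + x j ^ 2 + x k ^ 2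
        - (aOf b i.castSucc * aOf b 3 + aOf b j.castSucc * aOf b k.castSucc) * x i
        - (aOf b j.castSucc * aOf b 3 + aOf b i.castSucc * aOf b k.castSucc) * x j
        - (aOf b k.castSucc * aOf b 3 + aOf b i.castSucc * aOf b j.castSucc) * x k
        + (aOf b i.castSucc * aOf b j.castSucc * aOf b k.castSucc * aOf b 3
          + aOf b i.castSucc ^ 2 + aOf b j.castSucc ^ 2 + aOf b k.castSucc ^ 2
          + aOf b 3 ^ 2 - 4) := by
  have h0 : (0 : Fin 3).castSucc = (0 : Fin 4) := rfl
  have h1 : (1 : Fin 3).castSucc = (1 : Fin 4) := rfl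
  have h2 : (2 : Fin 3).castSucc = (2 : Fin 4) := rfl
  fin_cases i <;> fin_cases j <;> fin_cases k <;>
    simp_all [fcubic, thetaOf] <;> ring

/-- for `b ∈ (ℂ^×)⁴`, `θ = θ(b)` and `{i,j,k} = {1,2,3}`, the two affine lines
`Eᵢ = {xᵢ = bᵢb₄+(bᵢb₄)⁻¹, xⱼ+(bᵢb₄)x_k = a_kbᵢ+aⱼb₄}` and
`Eⱼ = {xᵢ = bⱼb_k+(bⱼb_k)⁻¹, xⱼ+(bⱼb_k)x_k = a₄bⱼ+aᵢb_k}` are contained in the affine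
cubic surface `S(θ)`. -/
theorem lines_on_cubic_surface (b : Fin 4 → ℂ) (hb : ∀ l, b l ≠ 0)
    (i j k : Fin 3) (hij : i ≠ j) (hjk : j ≠ k) (hik : i ≠ k) :
    (∀ x : Fin 3 → ℂ,
      (x i = b i.castSucc * b 3 + (b i.castSucc * b 3)⁻¹ ∧
        x j + (b i.castSucc * b 3) * x k
          = aOf b k.castSucc * b i.castSucc + aOf b j.castSucc * b 3) →
      fcubic (thetaOf b) x = 0) ∧
    (∀ x : Fin 3 → ℂ,
      (x i = b j.castSucc * b k.castSucc + (b j.castSucc * b k.castSucc)⁻¹ ∧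
        x j + (b j.castSucc * b k.castSucc) * x k
          = aOf b 3 * b j.castSucc + aOf b i.castSucc * b k.castSucc) →
      fcubic (thetaOf b) x = 0) := by
  constructor
  · rintro x ⟨hx, hline⟩
    rw [fcubic_thetaOf b x hij hjk hik]
    have h := cubic_eq_zero_of_mem_line (hb i.castSucc) (hb 3)
      (aOf b j.castSucc) (aOf b k.castSucc) _ _ _ hx hline
    simp only [← aOf.eq_1] at h
    linear_combination h
  · rintro x ⟨hx, hline⟩
    rw [fcubic_thetaOf b x hij hjk hik]
    have h := cubic_eq_zero_of_mem_line (hb j.castSucc) (hb k.castSucc)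
      (aOf b i.castSucc) (aOf b 3) _ _ _ hx hline
    simp only [← aOf.eq_1] at h
    linear_combination h
end
end

section
/- Let b∈(ℂ^×)⁴, aᵢ=bᵢ+bᵢ⁻¹, θ=θ(b), {i,j,k}={1,2,3}, and set β=bᵢb₄. Then a point x∈ℂ³ lies on the line Eᵢ and satisfies σᵢ(x)∈Eᵢ if and only if xᵢ = β+β⁻¹, xⱼ+βx_k = a_kbᵢ+aⱼb₄, and x_k is a root of the quadratic equation β·x_k² − (a_kbᵢ+aⱼb₄)·x_k + θᵢ − 2(β+β⁻¹) = 0. In particular Eᵢ ∩ σᵢ(Eᵢ) consists of at most two points, corresponding to the roots of this quadratic counted with multiplicity. -/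
open Finset

noncomputable section

theorem erase_eq_pair_of_ne {i j k : Fin 3} (hij : i ≠ j) (hjk : j ≠ k) (hik : i ≠ k) :
    Finset.univ.erase i = {j, k} := by
  decide +revert

theorem eq_or_eq_or_eq_of_ne {i j k : Fin 3} (hij : i ≠ j) (hjk : j ≠ k) (hik : i ≠ k)
    (l : Fin 3) : l = i ∨ l = j ∨ l = k := by
  omega

theorem sigmaMap_apply_self (θ : Fin 4 → ℂ) {i j k : Fin 3} (hij : i ≠ j) (hjk : j ≠ k)
    (hik : i ≠ k) (x : Fin 3 → ℂ) :
    sigmaMap θ i x i = θ i.castSucc - x i - x j * x k := by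
  simp [sigmaMap, erase_eq_pair_of_ne hij hjk hik, Finset.prod_pair hjk]

theorem sigmaMap_apply_of_ne (θ : Fin 4 → ℂ) {i l : Fin 3} (h : l ≠ i) (x : Fin 3 → ℂ) :
    sigmaMap θ i x l = x l :=
  Function.update_of_ne h _ _

/-- A complex quadratic polynomial has all its roots in a set of two elements. -/
theorem exists_roots_subset_pair {a : ℂ} (ha : a ≠ 0) (b c : ℂ) :
    ∃ r s : ℂ, ∀ z : ℂ, a * z ^ 2 - b * z + c = 0 → z ∈ ({r, s} : Set ℂ) := by
  obtain ⟨d, hd⟩ := IsAlgClosed.exists_pow_nat_eq (discrim a (-b) c) two_pos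
  refine ⟨_, _, fun z hz => (quadratic_eq_zero_iff ha (hd.symm.trans (sq d)) z).1 ?_⟩
  linear_combination hz

/-- with `β = bᵢb₄` and `A = a_kbᵢ + aⱼb₄`, a point `x` lies on `Eᵢ` with
`σᵢ(x) ∈ Eᵢ` iff `xᵢ = β+β⁻¹`, `xⱼ+βx_k = A` and `x_k` solves the quadratic
`β·x_k² − A·x_k + θᵢ − 2(β+β⁻¹) = 0`; in particular `Eᵢ ∩ σᵢ(Eᵢ)` consists of at most two
points. -/
theorem line_meets_its_sigma_image (b : Fin 4 → ℂ) (hb : ∀ l, b l ≠ 0)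
    (i j k : Fin 3) (hij : i ≠ j) (hjk : j ≠ k) (hik : i ≠ k) :
    let θ := thetaOf b
    let β := b i.castSucc * b 3
    let A := aOf b k.castSucc * b i.castSucc + aOf b j.castSucc * b 3
    let Ei : Set (Fin 3 → ℂ) := {x | x i = β + β⁻¹ ∧ x j + β * x k = A}
    (∀ x : Fin 3 → ℂ,
      (x ∈ Ei ∧ sigmaMap θ i x ∈ Ei) ↔
      (x i = β + β⁻¹ ∧ x j + β * x k = A ∧
        β * x k ^ 2 - A * x k + θ i.castSucc - 2 * (β + β⁻¹) = 0)) ∧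
    {x : Fin 3 → ℂ | x ∈ Ei ∧ sigmaMap θ i x ∈ Ei}.Finite ∧
    {x : Fin 3 → ℂ | x ∈ Ei ∧ sigmaMap θ i x ∈ Ei}.ncard ≤ 2 := by
  intro θ β A Ei
  have hβ : β ≠ 0 := mul_ne_zero (hb _) (hb _)
  have key : ∀ x : Fin 3 → ℂ, (x ∈ Ei ∧ sigmaMap θ i x ∈ Ei) ↔
      (x i = β + β⁻¹ ∧ x j + β * x k = A ∧
        β * x k ^ 2 - A * x k + θ i.castSucc - 2 * (β + β⁻¹) = 0) := by
    intro x
    simp only [Ei, Set.mem_ofPred_eq, sigmaMap_apply_self θ hij hjk hik,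
      sigmaMap_apply_of_ne θ hij.symm, sigmaMap_apply_of_ne θ hik.symm]
    constructor
    · rintro ⟨⟨hi, hj⟩, hσ, -⟩
      exact ⟨hi, hj, by linear_combination hσ + hi + x k * hj⟩
    · rintro ⟨hi, hj, hq⟩
      exact ⟨⟨hi, hj⟩, by linear_combination hq - hi - x k * hj, hj⟩
  obtain ⟨r, s, hrs⟩ := exists_roots_subset_pair hβ A (θ i.castSucc - 2 * (β + β⁻¹))
  have maps : ∀ x ∈ {x : Fin 3 → ℂ | x ∈ Ei ∧ sigmaMap θ i x ∈ Ei}, x k ∈ ({r, s} : Set ℂ) := by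
    intro x hx
    exact hrs _ (by linear_combination ((key x).1 hx).2.2)
  have inj : Set.InjOn (fun x : Fin 3 → ℂ => x k)
      {x : Fin 3 → ℂ | x ∈ Ei ∧ sigmaMap θ i x ∈ Ei} := by
    rintro x ⟨⟨hxi, hxj⟩, -⟩ y ⟨⟨hyi, hyj⟩, -⟩ (h : x k = y k)
    funext l
    obtain rfl | rfl | rfl := eq_or_eq_or_eq_of_ne hij hjk hik l
    · exact hxi.trans hyi.symm
    · linear_combination hxj - hyj - β * h
    · exact h
  have fin : ({r, s} : Set ℂ).Finite := Set.toFinite _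
  exact ⟨key, Set.Finite.of_injOn maps inj fin,
    (Set.ncard_le_ncard_of_injOn _ maps inj fin).trans ((Set.ncard_insert_le r {s}).trans (by simp))⟩
end
end

section
/- Let b∈(ℂ^×)⁴, aᵢ=bᵢ+bᵢ⁻¹, θ=θ(b), {i,j,k}={1,2,3}, and assume bⱼb_k ≠ bᵢb₄. Then there exists exactly one point x∈ℂ³ lying on the line Eⱼ with σᵢ(x)∈Eᵢ; that is, the curve σᵢ(Eᵢ) intersects the line Eⱼ in precisely one point. -/
open Finset

noncomputable section

theorem thetaOf_castSucc (b : Fin 4 → ℂ) {i j k : Fin 3} (hij : i ≠ j) (hjk : j ≠ k)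
    (hik : i ≠ k) :
    thetaOf b i.castSucc
      = aOf b i.castSucc * aOf b 3 + aOf b j.castSucc * aOf b k.castSucc := by
  fin_cases i <;> fin_cases j <;> fin_cases k <;> simp_all [thetaOf] <;> ring

theorem prod_erase_fin_three (x : Fin 3 → ℂ) {i j k : Fin 3} (hij : i ≠ j) (hjk : j ≠ k)
    (hik : i ≠ k) : ∏ l ∈ Finset.univ.erase i, x l = x j * x k := by
  have h : Finset.univ.erase i = {j, k} := by
    revert i j k
    decide
  rw [h, Finset.prod_pair hjk]

theorem sigmaMap_self (θ : Fin 4 → ℂ) (x : Fin 3 → ℂ) {i j k : Fin 3} (hij : i ≠ j)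
    (hjk : j ≠ k) (hik : i ≠ k) :
    sigmaMap θ i x i = θ i.castSucc - x i - x j * x k := by
  rw [sigmaMap, Function.update_self, prod_erase_fin_three x hij hjk hik]

theorem sigmaMap_of_ne (θ : Fin 4 → ℂ) (x : Fin 3 → ℂ) {i l : Fin 3} (h : l ≠ i) :
    sigmaMap θ i x l = x l :=
  Function.update_of_ne h _ _

/-- if `bⱼb_k ≠ bᵢb₄`, there is exactly one point `x` on the line `Eⱼ` with
`σᵢ(x) ∈ Eᵢ`; that is, the curve `σᵢ(Eᵢ)` meets the line `Eⱼ` in precisely one point. -/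
theorem sigma_image_meets_other_line_once (b : Fin 4 → ℂ) (hb : ∀ l, b l ≠ 0)
    (i j k : Fin 3) (hij : i ≠ j) (hjk : j ≠ k) (hik : i ≠ k)
    (hdet : b j.castSucc * b k.castSucc ≠ b i.castSucc * b 3) :
    ∃! x : Fin 3 → ℂ,
      (x i = b j.castSucc * b k.castSucc + (b j.castSucc * b k.castSucc)⁻¹ ∧
        x j + (b j.castSucc * b k.castSucc) * x k
          = aOf b 3 * b j.castSucc + aOf b i.castSucc * b k.castSucc) ∧
      (sigmaMap (thetaOf b) i x) i = b i.castSucc * b 3 + (b i.castSucc * b 3)⁻¹ ∧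
      (sigmaMap (thetaOf b) i x) j
          + (b i.castSucc * b 3) * (sigmaMap (thetaOf b) i x) k
        = aOf b k.castSucc * b i.castSucc + aOf b j.castSucc * b 3 := by
  have hbi := hb i.castSucc
  have hbj := hb j.castSucc
  have hbk := hb k.castSucc
  have hb4 := hb 3
  simp only [sigmaMap_self _ _ hij hjk hik, sigmaMap_of_ne _ _ hij.symm,
    sigmaMap_of_ne _ _ hik.symm, thetaOf_castSucc b hij hjk hik, aOf]
  generalize b i.castSucc = p at *
  generalize b j.castSucc = q at *
  generalize b k.castSucc = r at *
  generalize b 3 = s at *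
  have hline_j : s * q + p * r + q * r * ((s * r)⁻¹ + (p * q)⁻¹)
      = (s + s⁻¹) * q + (p + p⁻¹) * r := by
    field_simp
    ring
  have hline_i : s * q + p * r + p * s * ((s * r)⁻¹ + (p * q)⁻¹)
      = (r + r⁻¹) * p + (q + q⁻¹) * s := by
    field_simp
    ring
  refine ⟨Function.update (Function.update (fun _ => q * r + (q * r)⁻¹) j (s * q + p * r)) k
    ((s * r)⁻¹ + (p * q)⁻¹), ?_, ?_⟩
  · simp only [Function.update_self, Function.update_of_ne hij, Function.update_of_ne hik,
      Function.update_of_ne hjk]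
    refine ⟨⟨trivial, hline_j⟩, ?_, hline_i⟩
    field_simp
    ring
  · rintro x ⟨⟨hxi, hxj⟩, -, hxk⟩
    have hk : x k = (s * r)⁻¹ + (p * q)⁻¹ := by
      apply mul_left_cancel₀ (sub_ne_zero.mpr hdet)
      linear_combination hxj - hxk - hline_j + hline_i
    have hj : x j = s * q + p * r := by
      linear_combination hxj - hline_j - q * r * hk
    ext l
    have hl : l = i ∨ l = j ∨ l = k := by
      clear * - hij hjk hik
      revert i j k l
      decide
    rcases hl with rfl | rfl | rfl
    · simp [hij, hik, hxi]
    · simp [hjk, hj]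
    · simp [hk]
end
end

section
/- The characteristic polynomial of the 7×7 integer matrix C (the matrix of the pullback c* of the Coxeter transformation on H²(S̄(θ),ℤ)) is det(x·I − C) = x·(x+1)⁴·(x²−4x−1). -/
noncomputable section

/-- Matrix of the Coxeter pullback `c*` on `H²(S̄(θ),ℤ)` in the basis `(E₀,…,E₆)`. -/
def CoxMat : Matrix (Fin 7) (Fin 7) ℤ :=
  !![12,  6,  6,  4,  4,  3,  3;
     -3, -2, -1, -1, -1, -1, -1;
     -3, -1, -2, -1, -1, -1, -1;
     -4, -2, -2, -2, -1, -1, -1;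
     -4, -2, -2, -1, -2, -1, -1;
     -6, -3, -3, -2, -2, -2, -1;
     -6, -3, -3, -2, -2, -1, -2]

/-- The rows and columns of `CoxMat + 1` are constant on the blocks `{0}, {1,2}, {3,4}, {5,6}`;
this is the indicator matrix of these blocks. -/
def coxBlocks : Matrix (Fin 7) (Fin 4) ℤ :=
  !![1, 0, 0, 0;
     0, 1, 0, 0;
     0, 1, 0, 0;
     0, 0, 1, 0;
     0, 0, 1, 0;
     0, 0, 0, 1;
     0, 0, 0, 1]

/-- The matrix of block values of `CoxMat + 1`. -/
def coxReduced : Matrix (Fin 4) (Fin 4) ℤ :=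
  !![13,  6,  4,  3;
     -3, -1, -1, -1;
     -4, -2, -1, -1;
     -6, -3, -2, -1]

open Matrix in
theorem coxMat_eq :
    CoxMat = coxBlocks * coxReduced * coxBlocksᵀ - Matrix.scalar (Fin 7) 1 := by
  rw [map_one]
  decide +kernel

open Matrix in
theorem coxBlocks_transpose_mul :
    coxBlocksᵀ * (coxBlocks * coxReduced) =
      !![ 13,  6,  4,  3;
          -6, -2, -2, -2;
          -8, -4, -2, -2;
         -12, -6, -4, -2] := by
  decide +kernel

open Polynomial Matrix in
theorem coxBlocks_transpose_mul_charpoly :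
    (coxBlocksᵀ * (coxBlocks * coxReduced)).charpoly = X * (X - 1) * (X ^ 2 - 6 * X + 4) := by
  rw [coxBlocks_transpose_mul, Matrix.charpoly, Matrix.det_succ_row_zero]
  simp [Fin.sum_univ_succ, Matrix.det_fin_three, Matrix.charmatrix_apply, Fin.succAbove]
  ring

open Polynomial in
/-- the characteristic polynomial `det(x·I − C)` of the Coxeter matrix is
`x·(x+1)⁴·(x²−4x−1)`. -/
theorem coxeter_matrix_charpoly :
    CoxMat.charpoly = X * (X + 1) ^ 4 * (X ^ 2 - 4 * X - 1) := by
  rw [coxMat_eq, Matrix.charpoly_sub_scalar,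
    Matrix.charpoly_mul_comm_of_le _ _ (by simp), coxBlocks_transpose_mul_charpoly]
  simp
  ring
end
end

section
/- For every integer N≥1, the trace of the N-th power of the matrix C, regarded as a real matrix, equals (2+√5)^N + (2−√5)^N + 4·(−1)^N. -/
noncomputable section

/-- The Coxeter matrix regarded as a real matrix. -/
def CoxMatR : Matrix (Fin 7) (Fin 7) ℝ := CoxMat.map (Int.cast : ℤ → ℝ)

/-- `CoxMat` is annihilated by `x (x + 1) (x² - 4 x - 1)`. -/
theorem coxMat_pow_four : CoxMat ^ 4 = (3 : ℤ) • CoxMat ^ 3 + (5 : ℤ) • CoxMat ^ 2 + CoxMat := by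
  simp only [pow_succ, pow_zero, one_mul]
  decide +kernel

theorem trace_coxMat :
    CoxMat.trace = 0 ∧ (CoxMat ^ 2).trace = 22 ∧ (CoxMat ^ 3).trace = 72 := by
  simp only [pow_succ, pow_zero, one_mul]
  decide +kernel

theorem trace_coxMat_pow_add_four (n : ℕ) :
    (CoxMat ^ (n + 4)).trace =
      3 * (CoxMat ^ (n + 3)).trace + 5 * (CoxMat ^ (n + 2)).trace + (CoxMat ^ (n + 1)).trace := by
  rw [pow_add, coxMat_pow_four, mul_add, mul_add, mul_smul_comm, mul_smul_comm, ← pow_add,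
    ← pow_add, ← pow_succ]
  simp only [Matrix.trace_add, Matrix.trace_smul, smul_eq_mul]

theorem trace_coxMatR_pow (n : ℕ) :
    (CoxMatR ^ n).trace = (((CoxMat ^ n).trace : ℤ) : ℝ) := by
  have h : CoxMatR ^ n = (CoxMat ^ n).map (Int.cast : ℤ → ℝ) :=
    (map_pow (Int.castRingHom ℝ).mapMatrix CoxMat n).symm
  simp [h, Matrix.trace]

/-- for every `N ≥ 1`, `tr(C^N) = (2+√5)^N + (2−√5)^N + 4·(−1)^N`. -/
theorem trace_of_coxeter_matrix_power (N : ℕ) (hN : 1 ≤ N) :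
    Matrix.trace (CoxMatR ^ N)
      = (2 + Real.sqrt 5) ^ N + (2 - Real.sqrt 5) ^ N + 4 * (-1) ^ N := by
  have h5 : Real.sqrt 5 ^ 2 = 5 := Real.sq_sqrt (by norm_num)
  rw [trace_coxMatR_pow]
  induction N using Nat.strong_induction_on with
  | _ N ih =>
    match N, hN with
    | 1, _ =>
      rw [pow_one, trace_coxMat.1]
      push_cast
      ring
    | 2, _ =>
      rw [trace_coxMat.2.1]
      push_cast
      linear_combination -2 * h5
    | 3, _ =>
      rw [trace_coxMat.2.2]
      push_cast
      linear_combination -12 * h5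
    | n + 4, _ =>
      have h1 := ih (n + 1) (by omega) (by omega)
      have h2 := ih (n + 2) (by omega) (by omega)
      have h3 := ih (n + 3) (by omega) (by omega)
      have hp : (2 + Real.sqrt 5) ^ 2 = 4 * (2 + Real.sqrt 5) + 1 := by
        linear_combination h5
      have hm : (2 - Real.sqrt 5) ^ 2 = 4 * (2 - Real.sqrt 5) + 1 := by
        linear_combination h5
      generalize 2 + Real.sqrt 5 = a at *
      generalize 2 - Real.sqrt 5 = b at *
      rw [trace_coxMat_pow_add_four]
      push_cast
      rw [h1, h2, h3]
      linear_combination -(a ^ n * (a ^ 2 + a)) * hp - (b ^ n * (b ^ 2 + b)) * hm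
end
end
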